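/- In the near-separable setting with m = r, any optimal solution A* of the minimum-volume-ellipsoid SDP associated with M̃ satisfies det(Wᵀ A* W) ≥ (1 + ε/σ_min(W))^{−2r}. -/

import Mathlib

open Matrix BigOperators

/-- Euclidean norm of a vector in `ℝ^m`. -/
noncomputable def colNorm {m : ℕ} (v : Fin m → ℝ) : ℝ := Real.sqrt (∑ i, (v i) ^ 2)

/-- Largest singular value of a matrix. -/
noncomputable def sigmaMax {m n : ℕ} (X : Matrix (Fin m) (Fin n) ℝ) : ℝ :=
  sSup {c : ℝ | ∃ v : Fin n → ℝ, colNorm v = 1 ∧ c = colNorm (X.mulVec v)}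

/-- Smallest singular value of a matrix. -/
noncomputable def sigmaMin {m n : ℕ} (X : Matrix (Fin m) (Fin n) ℝ) : ℝ :=
  sInf {c : ℝ | ∃ v : Fin n → ℝ, colNorm v = 1 ∧ c = colNorm (X.mulVec v)}

/-- Condition number `κ(X) = σ_max(X) / σ_min(X)`. -/
noncomputable def kappa {m n : ℕ} (X : Matrix (Fin m) (Fin n) ℝ) : ℝ :=
  sigmaMax X / sigmaMin X

/-- Largest eigenvalue of a symmetric matrix, via the Rayleigh quotient. -/
noncomputable def lamMax {r : ℕ} (C : Matrix (Fin r) (Fin r) ℝ) : ℝ :=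
  sSup {c : ℝ | ∃ v : Fin r → ℝ, colNorm v = 1 ∧ c = v ⬝ᵥ C.mulVec v}

/-- Smallest eigenvalue of a symmetric matrix, via the Rayleigh quotient. -/
noncomputable def lamMin {r : ℕ} (C : Matrix (Fin r) (Fin r) ℝ) : ℝ :=
  sInf {c : ℝ | ∃ v : Fin r → ℝ, colNorm v = 1 ∧ c = v ⬝ᵥ C.mulVec v}

/-- Near-separable assumption with `m = r`: `Mt = W * H + N` where `W ∈ ℝ^{r×r}` is
invertible, `H = [I_r, H']` is nonnegative with column sums at most one and whose first `r`
columns form the identity matrix, and each column of `N` has Euclidean norm at most `ε`. -/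
def NearSepSquare (r n : ℕ) (W : Matrix (Fin r) (Fin r) ℝ) (H : Matrix (Fin r) (Fin n) ℝ)
    (N Mt : Matrix (Fin r) (Fin n) ℝ) (ε : ℝ) : Prop :=
  IsUnit W.det ∧ Mt = W * H + N ∧ (∀ i j, 0 ≤ H i j) ∧ (∀ j, ∑ i, H i j ≤ 1) ∧
    (∃ h : r ≤ n, ∀ i j : Fin r, H i (Fin.castLE h j) = if i = j then 1 else 0) ∧
    0 ≤ ε ∧ ∀ j, colNorm (fun i => N i j) ≤ ε

/-- `A` is feasible for the minimum-volume-ellipsoid SDP associated with `Mt`: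
`A` is positive semidefinite and `m̃ᵢᵀ A m̃ᵢ ≤ 1` for every column `m̃ᵢ` of `Mt`. -/
def SDPFeasible {r n : ℕ} (Mt : Matrix (Fin r) (Fin n) ℝ)
    (A : Matrix (Fin r) (Fin r) ℝ) : Prop :=
  A.PosSemidef ∧ ∀ j : Fin n, (fun i => Mt i j) ⬝ᵥ A.mulVec (fun i => Mt i j) ≤ 1

/-- `A` is an optimal solution of the minimum-volume-ellipsoid SDP associated with `Mt`:
it is feasible and maximizes the determinant among the feasible matrices. -/
def SDPOptimal {r n : ℕ} (Mt : Matrix (Fin r) (Fin n) ℝ)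
    (A : Matrix (Fin r) (Fin r) ℝ) : Prop :=
  SDPFeasible Mt A ∧ ∀ B : Matrix (Fin r) (Fin r) ℝ, SDPFeasible Mt B → B.det ≤ A.det

theorem colNorm_eq_norm {m : ℕ} (v : Fin m → ℝ) : colNorm v = ‖WithLp.toLp 2 v‖ := by
  simp [colNorm, EuclideanSpace.norm_eq]

theorem colNorm_nonneg {m : ℕ} (v : Fin m → ℝ) : 0 ≤ colNorm v := Real.sqrt_nonneg _

theorem colNorm_add_le {m : ℕ} (v w : Fin m → ℝ) :
    colNorm (v + w) ≤ colNorm v + colNorm w := by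
  simp only [colNorm_eq_norm, WithLp.toLp_add]
  exact norm_add_le _ _

theorem colNorm_smul {m : ℕ} (c : ℝ) (v : Fin m → ℝ) : colNorm (c • v) = |c| * colNorm v := by
  simp only [colNorm_eq_norm, WithLp.toLp_smul, norm_smul, Real.norm_eq_abs]

theorem colNorm_sq {m : ℕ} (v : Fin m → ℝ) : colNorm v ^ 2 = v ⬝ᵥ v := by
  rw [colNorm, Real.sq_sqrt (Finset.sum_nonneg fun i _ => sq_nonneg _)]
  simp [dotProduct, sq]

theorem colNorm_le_one_of_sum_le_one {m : ℕ} {v : Fin m → ℝ} (h0 : ∀ i, 0 ≤ v i)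
    (h1 : ∑ i, v i ≤ 1) : colNorm v ≤ 1 := by
  refine Real.sqrt_le_one.mpr (le_trans (Finset.sum_le_sum fun i _ => ?_) h1)
  have : v i ≤ 1 := (Finset.single_le_sum (fun j _ => h0 j) (Finset.mem_univ i)).trans h1
  nlinarith [h0 i]

theorem sigmaMin_mul_colNorm_le {m n : ℕ} (X : Matrix (Fin m) (Fin n) ℝ) (v : Fin n → ℝ) :
    sigmaMin X * colNorm v ≤ colNorm (X *ᵥ v) := by
  rcases (colNorm_nonneg v).eq_or_lt with h | h
  · simpa [← h] using colNorm_nonneg _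
  · have hle : sigmaMin X ≤ colNorm (X *ᵥ ((colNorm v)⁻¹ • v)) := by
      refine csInf_le ⟨0, ?_⟩ ⟨_, ?_, rfl⟩
      · rintro _ ⟨w, -, rfl⟩
        exact colNorm_nonneg _
      · rw [colNorm_smul, abs_of_pos (inv_pos.mpr h), inv_mul_cancel₀ h.ne']
    rw [mulVec_smul, colNorm_smul, abs_of_pos (inv_pos.mpr h), inv_mul_eq_div,
      le_div_iff₀ h] at hle
    exact hle

theorem exists_colNorm_mulVec_le {m n : ℕ} (X : Matrix (Fin m) (Fin n) ℝ) :
    ∃ K > 0, ∀ v, colNorm (X *ᵥ v) ≤ K * colNorm v := by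
  obtain ⟨K, hK, h⟩ := (LinearMap.toContinuousLinearMap (toEuclideanLin X)).bound
  refine ⟨K, hK, fun v => ?_⟩
  simpa [colNorm_eq_norm] using h (WithLp.toLp 2 v)

theorem sigmaMin_pos {r : ℕ} (hr : 0 < r) {W : Matrix (Fin r) (Fin r) ℝ} (hW : IsUnit W.det) :
    0 < sigmaMin W := by
  obtain ⟨K, hK, h⟩ := exists_colNorm_mulVec_le W⁻¹
  refine lt_of_lt_of_le (inv_pos.mpr hK) (le_csInf ?_ ?_)
  · refine ⟨_, Pi.single ⟨0, hr⟩ 1, ?_, rfl⟩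
    rw [colNorm_eq_norm]
    simp
  · rintro _ ⟨v, hv, rfl⟩
    have := h (W *ᵥ v)
    rw [mulVec_mulVec, nonsing_inv_mul _ hW, one_mulVec, hv] at this
    rwa [inv_le_iff_one_le_mul₀' hK]

/-- The ellipsoid `‖W⁻¹ x‖ ≤ s` contains the columns of `Mt` as soon as each `W⁻¹ m̃ⱼ` has norm
at most `s`. -/
theorem sdpFeasible_smul_inv {r n : ℕ} {Mt : Matrix (Fin r) (Fin n) ℝ}
    (V : Matrix (Fin r) (Fin r) ℝ) {s : ℝ} (hs : 0 < s)
    (h : ∀ j, colNorm (V *ᵥ fun i => Mt i j) ≤ s) :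
    SDPFeasible Mt ((s ^ 2)⁻¹ • (Vᵀ * V)) := by
  refine ⟨?_, fun j => ?_⟩
  · have : (Vᵀ * V).PosSemidef := by
      simpa [conjTranspose_eq_transpose_of_trivial] using posSemidef_conjTranspose_mul_self V
    exact this.smul (by positivity)
  · rw [smul_mulVec, dotProduct_smul, ← mulVec_mulVec, dotProduct_mulVec, vecMul_transpose,
      ← colNorm_sq, smul_eq_mul, inv_mul_le_iff₀ (by positivity), mul_one]
    exact pow_le_pow_left₀ (colNorm_nonneg _) (h j) 2

theorem colNorm_inv_mulVec_le {r n : ℕ} {W : Matrix (Fin r) (Fin r) ℝ}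
    {H N Mt : Matrix (Fin r) (Fin n) ℝ} {ε : ℝ} (hr : 0 < r)
    (hsep : NearSepSquare r n W H N Mt ε) (j : Fin n) :
    colNorm (W⁻¹ *ᵥ fun i => Mt i j) ≤ 1 + ε / sigmaMin W := by
  obtain ⟨hW, rfl, h0, h1, -, -, hN⟩ := hsep
  have hcol : (fun i => (W * H + N) i j) = W *ᵥ (fun i => H i j) + fun i => N i j := by
    ext i
    simp [mul_apply, mulVec, dotProduct]
  rw [hcol, mulVec_add, mulVec_mulVec, nonsing_inv_mul _ hW, one_mulVec]
  refine (colNorm_add_le _ _).trans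
    (add_le_add (colNorm_le_one_of_sum_le_one (fun i => h0 i j) (h1 j)) ?_)
  rw [le_div_iff₀' (sigmaMin_pos hr hW)]
  refine (sigmaMin_mul_colNorm_le W _).trans ?_
  rw [mulVec_mulVec, mul_nonsing_inv _ hW, one_mulVec]
  exact hN j

/-- Lower bound on the determinant of `C* = Wᵀ A* W` for an optimal solution `A*` of the
minimum-volume-ellipsoid SDP: `det(C*) ≥ (1 + ε/σ_min(W))^{−2r}`. -/
theorem det_lower_bound (r n : ℕ) (W : Matrix (Fin r) (Fin r) ℝ)
    (H : Matrix (Fin r) (Fin n) ℝ) (N Mt : Matrix (Fin r) (Fin n) ℝ) (ε : ℝ)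
    (A : Matrix (Fin r) (Fin r) ℝ)
    (hsep : NearSepSquare r n W H N Mt ε) (hA : SDPOptimal Mt A) :
    ((1 + ε / sigmaMin W) ^ (2 * r))⁻¹ ≤ (Wᵀ * A * W).det := by
  rcases Nat.eq_zero_or_pos r with rfl | hr
  · simp
  have hW : IsUnit W.det := hsep.1
  have hε : 0 ≤ ε := hsep.2.2.2.2.2.1
  have hσ := sigmaMin_pos hr hW
  have hs : 0 < 1 + ε / sigmaMin W := by positivity
  have hdet := hA.2 _ (sdpFeasible_smul_inv W⁻¹ hs (colNorm_inv_mulVec_le hr hsep))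
  have hd : W.det ≠ 0 := hW.ne_zero
  rw [det_smul, det_mul, det_transpose, det_nonsing_inv, Ring.inverse_eq_inv',
    Fintype.card_fin, inv_pow, ← pow_mul] at hdet
  rw [det_mul, det_mul, det_transpose]
  calc ((1 + ε / sigmaMin W) ^ (2 * r))⁻¹
      = W.det ^ 2 * (((1 + ε / sigmaMin W) ^ (2 * r))⁻¹ * (W.det⁻¹ * W.det⁻¹)) := by
        field_simp
    _ ≤ W.det ^ 2 * A.det := mul_le_mul_of_nonneg_left hdet (sq_nonneg _)
    _ = W.det * A.det * W.det := by ring
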